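/- arXiv:2001.00687 — 2 statements merged into one kernel-verified Lean document; each statement's English description precedes it below -/
import Mathlib

section
/- Let α ∈ [0, π/2), let A, B ∈ M_n(ℂ) be sector matrices of angle α, and let v ∈ [0,1]. Then Re(((1-v)A + vB)^{-1}) ≤ sec²(α) · ((1-v) Re(A^{-1}) + v Re(B^{-1})) in the Loewner order. -/
open Matrix
open scoped ComplexOrder

/-- The real (Hermitian) part of a complex matrix: `Re A = (A + Aᴴ)/2`. -/
noncomputable def matRe {n : ℕ} (A : Matrix (Fin n) (Fin n) ℂ) : Matrix (Fin n) (Fin n) ℂ :=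
  (2⁻¹ : ℂ) • (A + Aᴴ)

/-- `A` is a sector matrix of angle `α`: its numerical range is contained in
`S_α = {z : Re z > 0, |Im z| ≤ tan α · Re z}`. -/
def InSector {n : ℕ} (α : ℝ) (A : Matrix (Fin n) (Fin n) ℂ) : Prop :=
  ∀ x : Fin n → ℂ, star x ⬝ᵥ x = 1 →
    0 < (star x ⬝ᵥ A *ᵥ x).re ∧
      |(star x ⬝ᵥ A *ᵥ x).im| ≤ Real.tan α * (star x ⬝ᵥ A *ᵥ x).re

noncomputable def gf {n : ℕ} (A : Matrix (Fin n) (Fin n) ℂ) (x y : Fin n → ℂ) : ℂ :=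
  star x ⬝ᵥ A *ᵥ y

lemma gf_add_left {n : ℕ} (A : Matrix (Fin n) (Fin n) ℂ) (x y z : Fin n → ℂ) :
    gf A (x + y) z = gf A x z + gf A y z := by
  simp [gf, add_dotProduct]

lemma gf_add_right {n : ℕ} (A : Matrix (Fin n) (Fin n) ℂ) (x y z : Fin n → ℂ) :
    gf A z (x + y) = gf A z x + gf A z y := by
  simp [gf, mulVec_add, dotProduct_add]

lemma gf_smul_left {n : ℕ} (A : Matrix (Fin n) (Fin n) ℂ) (c : ℂ) (x y : Fin n → ℂ) :
    gf A (c • x) y = star c * gf A x y := by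
  simp [gf, smul_dotProduct]

lemma gf_smul_right {n : ℕ} (A : Matrix (Fin n) (Fin n) ℂ) (c : ℂ) (x y : Fin n → ℂ) :
    gf A x (c • y) = c * gf A x y := by
  simp [gf, mulVec_smul, dotProduct_smul]

lemma gf_add_mat {n : ℕ} (A B : Matrix (Fin n) (Fin n) ℂ) (x y : Fin n → ℂ) :
    gf (A + B) x y = gf A x y + gf B x y := by
  simp [gf, add_mulVec, dotProduct_add]

lemma gf_sub_mat {n : ℕ} (A B : Matrix (Fin n) (Fin n) ℂ) (x y : Fin n → ℂ) :
    gf (A - B) x y = gf A x y - gf B x y := by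
  simp [gf, sub_mulVec, dotProduct_sub]

lemma gf_smul_mat {n : ℕ} (A : Matrix (Fin n) (Fin n) ℂ) (c : ℂ) (x y : Fin n → ℂ) :
    gf (c • A) x y = c * gf A x y := by
  simp [gf, smul_mulVec, dotProduct_smul]

lemma gf_rsmul_mat {n : ℕ} (A : Matrix (Fin n) (Fin n) ℂ) (c : ℝ) (x y : Fin n → ℂ) :
    gf (c • A) x y = (c : ℂ) * gf A x y := by
  simp [gf, smul_mulVec, dotProduct_smul]

lemma gf_conj {n : ℕ} (A : Matrix (Fin n) (Fin n) ℂ) (x y : Fin n → ℂ) :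
    gf Aᴴ x y = star (gf A y x) := by
  unfold gf
  rw [mulVec_conjTranspose, star_dotProduct_star, ← dotProduct_mulVec]

lemma gf_matRe {n : ℕ} (A : Matrix (Fin n) (Fin n) ℂ) (x y : Fin n → ℂ) :
    gf (matRe A) x y = 2⁻¹ * (gf A x y + star (gf A y x)) := by
  rw [matRe, gf_smul_mat, gf_add_mat, gf_conj]

lemma gf_matRe_self {n : ℕ} (A : Matrix (Fin n) (Fin n) ℂ) (x : Fin n → ℂ) :
    gf (matRe A) x x = ((gf A x x).re : ℂ) := by
  rw [gf_matRe]
  apply Complex.ext <;> simp <;> ring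

lemma sector_all {n : ℕ} {α : ℝ} {A : Matrix (Fin n) (Fin n) ℂ} (hA : InSector α A)
    (x : Fin n → ℂ) (hx : x ≠ 0) :
    0 < (gf A x x).re ∧ |(gf A x x).im| ≤ Real.tan α * (gf A x x).re := by
  have h0 : 0 < star x ⬝ᵥ x := by
    exact dotProduct_star_self_pos_iff.2 hx
  obtain ⟨hr, hi⟩ := Complex.pos_iff.1 h0
  set r := (star x ⬝ᵥ x).re with hrdef
  have hxr : star x ⬝ᵥ x = (r : ℂ) := Complex.ext (by simp [hrdef]) (by simp [← hi])
  set c : ℝ := (Real.sqrt r)⁻¹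
  have hc : 0 < c := by positivity
  have hcr : c * c * r = 1 := by
    have := Real.mul_self_sqrt hr.le
    have h2 : Real.sqrt r ≠ 0 := by positivity
    simp only [c]; field_simp; nlinarith
  have h1 : star ((c : ℂ) • x) ⬝ᵥ ((c : ℂ) • x) = 1 := by
    simp only [star_smul, smul_dotProduct, dotProduct_smul, hxr, smul_eq_mul]
    simp only [Complex.star_def, Complex.conj_ofReal]
    rw [← mul_assoc]; exact_mod_cast hcr
  have h2 := hA _ h1
  change 0 < (gf A _ _).re ∧ |(gf A _ _).im| ≤ Real.tan α * (gf A _ _).re at h2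
  have h3 : gf A ((c : ℂ) • x) ((c : ℂ) • x) = ((c * c : ℝ) : ℂ) * gf A x x := by
    rw [gf_smul_left, gf_smul_right]; simp; ring
  rw [h3, Complex.re_ofReal_mul, Complex.im_ofReal_mul, abs_mul,
    abs_of_pos (by positivity : 0 < c * c)] at h2
  have hcc : 0 < c * c := by positivity
  refine ⟨pos_of_mul_pos_right h2.1 hcc.le, ?_⟩
  refine le_of_mul_le_mul_left (h2.2.trans_eq (by ring)) hcc

lemma isUnit_of_pos {n : ℕ} {A : Matrix (Fin n) (Fin n) ℂ}
    (hA : ∀ x, x ≠ 0 → 0 < (gf A x x).re) : IsUnit A := by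
  rw [← mulVec_injective_iff_isUnit]
  intro x y hxy
  by_contra hne
  have h := hA (x - y) (sub_ne_zero.2 hne)
  have : A *ᵥ (x - y) = 0 := by rw [mulVec_sub]; exact sub_eq_zero.2 hxy
  simp [gf, this] at h

lemma mulVec_inv {n : ℕ} {A : Matrix (Fin n) (Fin n) ℂ} (hA : IsUnit A) (x : Fin n → ℂ) :
    A *ᵥ (A⁻¹ *ᵥ x) = x := by
  rw [mulVec_mulVec, mul_nonsing_inv _ ((isUnit_iff_isUnit_det A).1 hA), one_mulVec]

/-- Cauchy-Schwarz type inequality for sector matrices. -/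
lemma sector_cs {n : ℕ} {t : ℝ} (ht : 0 ≤ t) {A : Matrix (Fin n) (Fin n) ℂ}
    (hpos : ∀ x, x ≠ 0 → 0 < (gf A x x).re)
    (hsec : ∀ x, |(gf A x x).im| ≤ t * (gf A x x).re) (y a : Fin n → ℂ) :
    (gf A y a).re ≤ 2⁻¹ * (gf A y y).re + 2⁻¹ * (1 + t ^ 2) * (gf A a a).re := by
  have hnn : ∀ x, 0 ≤ (gf A x x).re := by
    intro x
    by_cases hx : x = 0
    · simp [hx, gf]
    · exact (hpos x hx).le
  have hPu : IsUnit (matRe A) := isUnit_of_pos fun x hx => by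
    rw [gf_matRe_self]; exact_mod_cast hpos x hx
  obtain ⟨w, hw⟩ : ∃ w, matRe A *ᵥ w = (A - matRe A) *ᵥ a := ⟨_, mulVec_inv hPu _⟩
  have key : ∀ u, gf (matRe A) u w = gf A u a - gf (matRe A) u a := fun u => by
    rw [← gf_sub_mat]; simp only [gf, hw]
  -- real parts of `key`
  have kr : ∀ u, (gf A u w).re + (gf A w u).re = (gf A u a).re - (gf A a u).re := fun u => by
    have h := congrArg Complex.re (key u)
    simp only [gf_matRe] at h
    simp at h
    linarith
  have ka := kr a
  have kw := kr w
  have ky := kr y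
  -- positivity at `y - (a + w)`
  have h1 := hnn (y + (-1 : ℂ) • (a + w))
  simp only [gf_add_left, gf_add_right, gf_smul_left, gf_smul_right] at h1
  simp at h1
  have h2 : ∀ s : ℝ, 4 * s * (gf A w w).re ≤
      t * (2 * (gf A w w).re + 2 * s ^ 2 * (gf A a a).re) := fun s => by
    have e1 := (abs_le.1 (hsec (w + (Complex.I * s) • a))).2
    have e2 := (abs_le.1 (hsec (w + (-(Complex.I * s)) • a))).1
    simp only [gf_add_left, gf_add_right, gf_smul_left, gf_smul_right] at e1 e2
    simp at e1 e2
    have kws : s * ((gf A w w).re + (gf A w w).re) = s * ((gf A w a).re - (gf A a w).re) := by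
      rw [kw]
    nlinarith
  have h3 : (gf A w w).re ≤ t ^ 2 * (gf A a a).re := by
    rcases ht.eq_or_lt with h | h
    · have := h2 1
      rw [← h] at this ⊢
      linarith
    · have := h2 t
      have h4 : t * (2 * (gf A w w).re) ≤ t * (2 * (t ^ 2 * (gf A a a).re)) := by linarith
      have := le_of_mul_le_mul_left h4 h
      linarith
  linarith

lemma gf_inv_re {n : ℕ} {A : Matrix (Fin n) (Fin n) ℂ} (hA : IsUnit A) (x : Fin n → ℂ) :
    (gf A⁻¹ x x).re = (gf A (A⁻¹ *ᵥ x) (A⁻¹ *ᵥ x)).re := by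
  have : gf A (A⁻¹ *ᵥ x) (A⁻¹ *ᵥ x) = star (gf A⁻¹ x x) := by
    unfold gf
    rw [mulVec_inv hA, star_dotProduct]
  rw [this]; simp

lemma matRe_herm {n : ℕ} (A : Matrix (Fin n) (Fin n) ℂ) : (matRe A)ᴴ = matRe A := by
  simp [matRe, conjTranspose_smul, add_comm]

/-- For sector matrices `A, B` of angle `α ∈ [0, π/2)` and `v ∈ [0,1]`,
`Re(((1-v)A + vB)⁻¹) ≤ sec²(α) · ((1-v) Re(A⁻¹) + v Re(B⁻¹))` in the Loewner order. -/
theorem stmt0 {n : ℕ} {α : ℝ} (hα : α ∈ Set.Ico 0 (Real.pi / 2))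
    {A B : Matrix (Fin n) (Fin n) ℂ} (hA : InSector α A) (hB : InSector α B)
    {v : ℝ} (hv : v ∈ Set.Icc (0 : ℝ) 1) :
    ((Real.cos α)⁻¹ ^ 2 • ((1 - v) • matRe A⁻¹ + v • matRe B⁻¹) -
      matRe ((1 - v) • A + v • B)⁻¹).PosSemidef := by
  obtain ⟨hα0, hα1⟩ := hα
  obtain ⟨hv0, hv1⟩ := hv
  have ht : 0 ≤ Real.tan α := Real.tan_nonneg_of_nonneg_of_le_pi_div_two hα0 hα1.le
  have hcos : 0 < Real.cos α := Real.cos_pos_of_mem_Ioo ⟨by linarith [Real.pi_pos], hα1⟩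
  have hsec : (Real.cos α)⁻¹ ^ 2 = 1 + Real.tan α ^ 2 := by
    rw [inv_pow, ← Real.inv_one_add_tan_sq hcos.ne', inv_inv]
  have hApos := fun x hx => (sector_all hA x hx).1
  have hBpos := fun x hx => (sector_all hB x hx).1
  have full : ∀ {D : Matrix (Fin n) (Fin n) ℂ}, InSector α D →
      ∀ x, |(gf D x x).im| ≤ Real.tan α * (gf D x x).re := by
    intro D hD x
    by_cases hx : x = 0
    · simp [hx, gf]
    · exact (sector_all hD x hx).2
  have hAu := isUnit_of_pos hApos
  have hBu := isUnit_of_pos hBpos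
  set C := (1 - v) • A + v • B with hC
  have hCre : ∀ x y, (gf C x y).re = (1 - v) * (gf A x y).re + v * (gf B x y).re := by
    intro x y
    rw [hC, gf_add_mat, gf_rsmul_mat, gf_rsmul_mat, Complex.add_re, Complex.re_ofReal_mul,
      Complex.re_ofReal_mul]
  have hCu : IsUnit C := isUnit_of_pos fun x hx => by
    rw [hCre]
    have h1 := hApos x hx
    have h2 := hBpos x hx
    rcases hv0.eq_or_lt with h | h
    · subst h; linarith
    · have := mul_pos h h2
      have := mul_nonneg (sub_nonneg.2 hv1) h1.le
      linarith
  refine PosSemidef.of_dotProduct_mulVec_nonneg ?_ fun x => ?_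
  · simp [IsHermitian, conjTranspose_sub, conjTranspose_smul, matRe_herm]
  change 0 ≤ gf _ x x
  rw [gf_sub_mat, gf_rsmul_mat, gf_add_mat, gf_rsmul_mat, gf_rsmul_mat, gf_matRe_self,
    gf_matRe_self, gf_matRe_self, gf_inv_re hAu, gf_inv_re hBu, gf_inv_re hCu, hsec]
  set y := C⁻¹ *ᵥ x
  have cA := sector_cs ht hApos (full hA) y (A⁻¹ *ᵥ x)
  have cB := sector_cs ht hBpos (full hB) y (B⁻¹ *ᵥ x)
  have eA : gf A y (A⁻¹ *ᵥ x) = gf C y y := by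
    unfold gf; rw [mulVec_inv hAu, mulVec_inv hCu]
  have eB : gf B y (B⁻¹ *ᵥ x) = gf C y y := by
    unfold gf; rw [mulVec_inv hBu, mulVec_inv hCu]
  rw [eA] at cA
  rw [eB] at cB
  have hy := hCre y y
  have m1 := mul_le_mul_of_nonneg_left cA (sub_nonneg.2 hv1)
  have m2 := mul_le_mul_of_nonneg_left cB hv0
  norm_cast
  linarith
end

section
/- Let α ∈ [0, π/2), let A ∈ M_n(ℂ) be a sector matrix of angle α with 0 < m·I_n ≤ Re A ≤ M·I_n for some 0 < m ≤ M, and set h = M/m. Then for every normalized positive linear map Φ : M_n(ℂ) → M_l(ℂ), the operator (spectral) norm satisfies ‖Φ((Re A)^{-1})·(Φ(Re(A^{-1})))^{-1}‖ ≤ sec²(α)·K(h)^{1/2}. -/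
open Matrix
open scoped ComplexOrder

/-- The Kantorovich constant `K(x) = (x+1)²/(4x)`. -/
noncomputable def kant (x : ℝ) : ℝ := (x + 1) ^ 2 / (4 * x)

section helpers

variable {k : ℕ}

lemma psd_smul {P : Matrix (Fin k) (Fin k) ℂ} (h : P.PosSemidef) {c : ℝ} (hc : 0 ≤ c) :
    (c • P).PosSemidef := h.smul hc

lemma psd_antisymm {P : Matrix (Fin k) (Fin k) ℂ} (h : P.PosSemidef) (h' : (-P).PosSemidef) :
    P = 0 := by
  open scoped MatrixOrder in
  refine le_antisymm (α := Matrix (Fin k) (Fin k) ℂ) ?_ ?_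
  · rw [Matrix.le_iff]; simpa using h'
  · rw [Matrix.le_iff]; simpa using h

lemma psd_conj {P B : Matrix (Fin k) (Fin k) ℂ} (h : P.PosSemidef) (hB : Bᴴ = B) :
    (B * P * B).PosSemidef := by
  have := h.mul_mul_conjTranspose_same B
  rwa [hB] at this

lemma parallel {P Q R W : Matrix (Fin k) (Fin k) ℂ} (hP : P.PosSemidef) (hQ : Q.PosSemidef)
    (hW : W.PosSemidef) (hRW : R * W = 1) (hWR : W * R = 1) {c : ℝ} (hc : 0 ≤ c)
    (hPQ : P + Q = c • R) : (P * W * Q).PosSemidef := by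
  rcases hc.eq_or_lt with rfl | hc
  · have hQP : Q = -P := by
      have : P + Q = 0 := by simpa using hPQ
      exact (neg_eq_of_add_eq_zero_right this).symm
    have : P = 0 := psd_antisymm hP (hQP ▸ hQ)
    simp [this, Matrix.PosSemidef.zero]
  · have e1 : P * W * Q = Q * W * P := by
      have hQ' : Q = c • R - P := by rw [← hPQ]; abel
      rw [hQ']
      simp only [mul_sub, sub_mul, mul_smul_comm, smul_mul_assoc, mul_assoc, hWR]
      rw [← mul_assoc R W P, hRW]; simp
    have e2 : c • (P * W * Q) = P * W * Q * (W * P) + Q * W * P * (W * Q) := by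
      have : c • (P * W * Q) = P * W * Q * W * (c • R) := by
        rw [mul_smul_comm, mul_assoc _ W R, hWR, mul_one]
      rw [this, ← hPQ, mul_add]
      nth_rewrite 2 [e1]
      simp only [mul_assoc]
    have e3 : (c • (P * W * Q)).PosSemidef := by
      rw [e2]
      refine Matrix.PosSemidef.add ?_ ?_
      · have := hQ.mul_mul_conjTranspose_same (P * W)
        rwa [conjTranspose_mul, hW.1.eq, hP.1.eq] at this
      · have := hP.mul_mul_conjTranspose_same (Q * W)
        rwa [conjTranspose_mul, hW.1.eq, hQ.1.eq] at this
    have := psd_smul e3 (inv_nonneg.2 hc.le)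
    rwa [smul_smul, inv_mul_cancel₀ hc.ne', one_smul] at this

lemma psd_one : (1 : Matrix (Fin k) (Fin k) ℂ).PosSemidef := Matrix.PosSemidef.one

lemma inv_lower {R W : Matrix (Fin k) (Fin k) ℂ} (hW : W.PosSemidef)
    (hWR : W * R = 1) (hRW : R * W = 1) {M : ℝ} (hM : 0 < M)
    (h2 : (M • (1 : Matrix (Fin k) (Fin k) ℂ) - R).PosSemidef) :
    (W - M⁻¹ • (1 : Matrix (Fin k) (Fin k) ℂ)).PosSemidef := by
  have e : W - M⁻¹ • (1 : Matrix (Fin k) (Fin k) ℂ) = (M⁻¹ * M⁻¹) •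
      ((M • 1 - R) + (M • 1 - R) * W * (M • 1 - R)) := by
    simp only [mul_sub, sub_mul, smul_mul_assoc, mul_smul_comm, hRW, one_mul, mul_one, smul_sub,
      smul_add, smul_smul]
    have : M⁻¹ * M⁻¹ * (M * M) = 1 := by field_simp
    have h3 : M⁻¹ * M⁻¹ * M = M⁻¹ := by field_simp
    simp only [this, h3, hWR]
    have : M⁻¹ * (M⁻¹ * (M * M)) = 1 := by field_simp
    module
  rw [e]
  exact psd_smul (h2.add (psd_conj hW h2.1.eq)) (by positivity)

lemma inv_upper {R W : Matrix (Fin k) (Fin k) ℂ} (hW : W.PosSemidef)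
    (hWR : W * R = 1) (hRW : R * W = 1) {m : ℝ} (hm : 0 < m)
    (h1 : (R - m • (1 : Matrix (Fin k) (Fin k) ℂ)).PosSemidef) :
    (m⁻¹ • (1 : Matrix (Fin k) (Fin k) ℂ) - W).PosSemidef := by
  have e : m⁻¹ • (1 : Matrix (Fin k) (Fin k) ℂ) - W = m⁻¹ •
      (W * ((R - m • 1) * 1 * (R - m • 1) + m • (R - m • 1)) * W) := by
    have : (R - m • 1) * 1 * (R - m • 1) + m • (R - m • 1) = (R - m • 1) * R := by
      simp only [mul_sub, sub_mul, smul_mul_assoc, mul_smul_comm, one_mul, mul_one, smul_sub]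
      abel
    rw [this, mul_assoc W, mul_assoc _ R W, hRW, mul_one, mul_sub, hWR, mul_smul_comm, mul_one,
      smul_sub, smul_smul, inv_mul_cancel₀ hm.ne', one_smul]
  rw [e]
  exact psd_smul (psd_conj ((psd_conj psd_one h1.1.eq).add (psd_smul h1 hm.le)) hW.1.eq)
    (by positivity)

lemma kantorovich {X Y : Matrix (Fin k) (Fin k) ℂ} {p q s : ℝ} (hp : 0 < p) (hpq : p ≤ q)
    (hYh : Yᴴ = Y)
    (hX1 : (X - p • (1 : Matrix (Fin k) (Fin k) ℂ)).PosSemidef)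
    (hX2 : (q • (1 : Matrix (Fin k) (Fin k) ℂ) - X).PosSemidef)
    (hXY : (s • Y - X).PosSemidef) :
    ((s ^ 2 * ((p + q) ^ 2 / (4 * (p * q)))) • (Y * Y) - X * X).PosSemidef := by
  have hq : 0 < q := hp.trans_le hpq
  have a1 := parallel (R := 1) hX1 hX2 psd_one (by simp) (by simp) (sub_nonneg.2 hpq)
    (by module)
  have a2 := psd_smul hXY (add_pos hp hq).le
  set Z : Matrix (Fin k) (Fin k) ℂ := (s * (p + q)) • Y - (2 * (p * q)) • 1 with hZ
  have hZh : Zᴴ = Z := by simp [hZ, hYh]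
  have a3 := psd_smul (psd_conj psd_one hZh) (c := (4 * (p * q))⁻¹) (by positivity)
  have := (a1.add a2).add a3
  convert this using 1
  simp only [hZ, mul_sub, sub_mul, smul_mul_assoc, mul_smul_comm, one_mul, mul_one, smul_sub,
    smul_smul]
  match_scalars <;> field_simp <;> ring

lemma opnorm_le {B : Matrix (Fin k) (Fin k) ℂ} {c : ℝ} (hc : 0 ≤ c)
    (h : ((c ^ 2) • (1 : Matrix (Fin k) (Fin k) ℂ) - Bᴴ * B).PosSemidef) :
    ‖Matrix.toEuclideanCLM (𝕜 := ℂ) B‖ ≤ c := by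
  refine ContinuousLinearMap.opNorm_le_bound _ hc fun w => ?_
  refine le_of_sq_le_sq ?_ (by positivity)
  have h3 := h.re_dotProduct_nonneg w.ofLp
  have key : ∀ v : Fin k → ℂ, RCLike.re (star v ⬝ᵥ v) = ‖WithLp.toLp 2 v‖ ^ 2 := by
    intro v
    rw [EuclideanSpace.norm_sq_eq]
    simp [dotProduct, ← Complex.normSq_eq_norm_sq, Complex.normSq_apply]
  rw [sub_mulVec, dotProduct_sub, smul_mulVec, one_mulVec, dotProduct_smul, ← mulVec_mulVec,
    dotProduct_mulVec, ← star_mulVec, map_sub, key, RCLike.smul_re, key] at h3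
  have : Matrix.toEuclideanCLM (𝕜 := ℂ) B w = WithLp.toLp 2 (B *ᵥ w.ofLp) := rfl
  rw [this, mul_pow]
  linarith [h3]

end helpers

lemma sector_inv {n : ℕ} {α : ℝ} (hα : α ∈ Set.Ico 0 (Real.pi / 2))
    {A : Matrix (Fin n) (Fin n) ℂ} (hA : InSector α A) (hR : (matRe A).PosDef) :
    (matRe A⁻¹ - (Real.cos α ^ 2) • (matRe A)⁻¹).PosSemidef := by
  set R := matRe A with hRdef
  set W := R⁻¹ with hWdef
  have hdet : IsUnit R.det := (Matrix.isUnit_iff_isUnit_det _).1 hR.isUnit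
  have hRW : R * W = 1 := Matrix.mul_nonsing_inv _ hdet
  have hWR : W * R = 1 := Matrix.nonsing_inv_mul _ hdet
  have hW : W.PosSemidef := hR.inv.posSemidef
  have hcos : 0 < Real.cos α := Real.cos_pos_of_mem_Ioo
    ⟨by linarith [hα.1, Real.pi_pos], hα.2⟩
  have ht : 0 ≤ Real.tan α := Real.tan_nonneg_of_nonneg_of_le_pi_div_two hα.1 hα.2.le
  set t := Real.tan α with htdef
  set S : Matrix (Fin n) (Fin n) ℂ := (-(Complex.I / 2)) • (A - Aᴴ) with hS
  have hAS : A = R + Complex.I • S := by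
    rw [hRdef, hS, matRe, smul_smul, show Complex.I * -(Complex.I / 2) = 2⁻¹ by
      linear_combination (-1/2 : ℂ) * Complex.I_mul_I]
    module
  have hSh : Sᴴ = S := by
    rw [hS, conjTranspose_smul, conjTranspose_sub, conjTranspose_conjTranspose]
    simp only [star_neg, star_div₀, RCLike.star_def, Complex.conj_I, map_ofNat]
    module
  have hRh : Rᴴ = R := hR.1.eq
  have hAH : Aᴴ = R - Complex.I • S := by
    rw [hAS, conjTranspose_add, conjTranspose_smul, hSh, hRh]
    simp [sub_eq_add_neg]
  -- quadratic forms
  have hquad : ∀ x : Fin n → ℂ, |(star x ⬝ᵥ A *ᵥ x).im| ≤ t * (star x ⬝ᵥ A *ᵥ x).re := by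
    intro x
    by_cases hx : x = 0
    · simp [hx]
    have hpos : 0 < star x ⬝ᵥ x := dotProduct_star_self_pos_iff.2 hx
    obtain ⟨hr, hi⟩ := Complex.lt_def.1 hpos
    set r := (star x ⬝ᵥ x).re with hrdef
    have hxr : star x ⬝ᵥ x = (r : ℂ) := Complex.ext (by simp [hrdef]) (by simpa using hi.symm)
    have hr0 : 0 < r := by simpa using hr
    have hsc : ∀ v : Fin n → ℂ, star ((√r)⁻¹ • x) ⬝ᵥ ((√r)⁻¹ • v) = r⁻¹ • (star x ⬝ᵥ v) := by
      intro v
      rw [star_smul, smul_dotProduct, dotProduct_smul, smul_smul, star_trivial, ← mul_inv,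
        Real.mul_self_sqrt hr0.le]
    have h := (hA ((√r)⁻¹ • x) (by
      rw [hsc, hxr, Complex.real_smul, ← Complex.ofReal_mul, inv_mul_cancel₀ hr0.ne',
        Complex.ofReal_one])).2
    rw [mulVec_smul, hsc, Complex.smul_re, Complex.smul_im, smul_eq_mul, smul_eq_mul, abs_mul,
      abs_of_pos (inv_pos.2 hr0), mul_left_comm] at h
    exact le_of_mul_le_mul_left h (inv_pos.2 hr0)
  have hre : ∀ {H : Matrix (Fin n) (Fin n) ℂ}, Hᴴ = H → ∀ x, (star x ⬝ᵥ H *ᵥ x).im = 0 := by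
    intro H hH x
    exact Matrix.IsHermitian.im_star_dotProduct_mulVec_self hH x
  have hform : ∀ x : Fin n → ℂ, |(star x ⬝ᵥ S *ᵥ x).re| ≤ t * (star x ⬝ᵥ R *ᵥ x).re := by
    intro x
    have := hquad x
    rw [hAS, add_mulVec, smul_mulVec, dotProduct_add, dotProduct_smul] at this
    simpa [hre hRh x, hre hSh x] using this
  have mk : ∀ {H : Matrix (Fin n) (Fin n) ℂ}, Hᴴ = H → (∀ x, 0 ≤ (star x ⬝ᵥ H *ᵥ x).re) →
      H.PosSemidef := by
    intro H hH h
    refine Matrix.PosSemidef.of_dotProduct_mulVec_nonneg hH fun x => ?_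
    rw [Complex.le_def]
    exact ⟨h x, (hre hH x).symm⟩
  have hP : (t • R - S).PosSemidef := by
    refine mk (by simp [hRh, hSh]) fun x => ?_
    have := (abs_le.1 (hform x)).2
    rw [sub_mulVec, dotProduct_sub, smul_mulVec, dotProduct_smul]
    simpa using this
  have hQ : (t • R + S).PosSemidef := by
    refine mk (by simp [hRh, hSh]) fun x => ?_
    have := (abs_le.1 (hform x)).1
    rw [add_mulVec, dotProduct_add, smul_mulVec, dotProduct_smul]
    simp
    linarith
  have hpar := parallel hP hQ hW hRW hWR (c := 2 * t) (by positivity) (by module)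
  have hAu : IsUnit A := by
    rw [← Matrix.mulVec_injective_iff_isUnit]
    intro a b hab
    by_contra hne
    have hx : a - b ≠ 0 := sub_ne_zero.2 hne
    have h0 : A *ᵥ (a - b) = 0 := by rw [mulVec_sub]; exact sub_eq_zero.2 hab
    have hp := (Complex.lt_def.1 (hR.dotProduct_mulVec_pos hx)).1
    have h0' : (star (a - b) ⬝ᵥ A *ᵥ (a - b)).re = 0 := by rw [h0]; simp
    have hAx : (star (a - b) ⬝ᵥ A *ᵥ (a - b)).re = (star (a - b) ⬝ᵥ R *ᵥ (a - b)).re := by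
      conv_lhs => rw [hAS]
      rw [add_mulVec, smul_mulVec, dotProduct_add, dotProduct_smul]
      simp [-star_sub, hre hSh (a - b)]
    rw [← hAx, h0'] at hp
    simp at hp
  have hAdet : IsUnit A.det := (Matrix.isUnit_iff_isUnit_det _).1 hAu
  have hAA : A * A⁻¹ = 1 := Matrix.mul_nonsing_inv _ hAdet
  have hAA' : A⁻¹ * A = 1 := Matrix.nonsing_inv_mul _ hAdet
  have hAAh : Aᴴ * (A⁻¹)ᴴ = 1 := by rw [← conjTranspose_mul, hAA', conjTranspose_one]
  have hAAh' : (A⁻¹)ᴴ * Aᴴ = 1 := by rw [← conjTranspose_mul, hAA, conjTranspose_one]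
  have e1 : Aᴴ * matRe A⁻¹ * A = R := by
    rw [hRdef, matRe, matRe, mul_smul_comm, smul_mul_assoc, mul_add, add_mul, hAAh, mul_assoc, hAA',
      mul_one, one_mul, add_comm]
  have e2 : Aᴴ * W * A = R + S * W * S := by
    rw [hAH, show (R - Complex.I • S) * W * A = (R - Complex.I • S) * W * (R + Complex.I • S) from
      congrArg _ hAS]
    simp only [sub_mul, mul_add, smul_mul_assoc, mul_smul_comm, hRW, one_mul, smul_smul,
      mul_assoc, hWR, mul_one]
    match_scalars <;> simp
  have e3 : (t • R - S) * W * (t • R + S) = (t ^ 2) • R - S * W * S := by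
    simp only [sub_mul, mul_add, smul_mul_assoc, mul_smul_comm, hRW, one_mul, smul_smul,
      mul_assoc, hWR, mul_one]
    module
  have e4 : Aᴴ * (matRe A⁻¹ - (Real.cos α ^ 2) • W) * A =
      (Real.cos α ^ 2) • ((t • R - S) * W * (t • R + S)) := by
    rw [mul_sub, sub_mul, e1, mul_smul_comm, smul_mul_assoc, e2, e3]
    have : Real.cos α ^ 2 * t ^ 2 = 1 - Real.cos α ^ 2 := by
      rw [htdef, Real.tan_eq_sin_div_cos, ← Real.sin_sq]
      field_simp
    rw [smul_sub, smul_smul, this]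
    module
  have e5 : (Aᴴ * (matRe A⁻¹ - (Real.cos α ^ 2) • W) * A).PosSemidef := by
    rw [e4]; exact psd_smul hpar (by positivity)
  have := e5.conjTranspose_mul_mul_same A⁻¹
  rwa [mul_assoc _ _ A⁻¹, mul_assoc _ A, hAA, mul_one, ← mul_assoc, hAAh', one_mul] at this

/-- For a sector matrix `A` of angle `α ∈ [0, π/2)` with `0 < m·I ≤ Re A ≤ M·I`, `h = M/m`,
and every normalized positive linear map `Φ`, the operator norm satisfies
`‖Φ((Re A)⁻¹)Φ(Re(A⁻¹))⁻¹‖ ≤ sec²(α) K(h)^{1/2}`. -/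
theorem stmt15 {n l : ℕ} {α : ℝ} (hα : α ∈ Set.Ico 0 (Real.pi / 2))
    {A : Matrix (Fin n) (Fin n) ℂ} (hA : InSector α A)
    {m M : ℝ} (hm : 0 < m) (hmM : m ≤ M)
    (h1 : (matRe A - m • 1).PosSemidef)
    (h2 : (M • (1 : Matrix (Fin n) (Fin n) ℂ) - matRe A).PosSemidef)
    (Φ : Matrix (Fin n) (Fin n) ℂ →ₗ[ℂ] Matrix (Fin l) (Fin l) ℂ)
    (hΦpos : ∀ X : Matrix (Fin n) (Fin n) ℂ, X.PosSemidef → (Φ X).PosSemidef)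
    (hΦ1 : Φ 1 = 1) :
    ‖Matrix.toEuclideanCLM (𝕜 := ℂ) (Φ ((matRe A)⁻¹) * (Φ (matRe A⁻¹))⁻¹)‖ ≤
      (Real.cos α)⁻¹ ^ 2 * Real.sqrt (kant (M / m)) := by
  set R := matRe A with hRdef
  have hM : 0 < M := hm.trans_le hmM
  have hR : R.PosDef := by
    have : R = (R - m • 1) + m • 1 := by abel
    rw [this]
    exact Matrix.PosDef.posSemidef_add h1 (Matrix.PosDef.one.smul hm)
  have hdet : IsUnit R.det := (Matrix.isUnit_iff_isUnit_det _).1 hR.isUnit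
  have hRW : R * R⁻¹ = 1 := Matrix.mul_nonsing_inv _ hdet
  have hWR : R⁻¹ * R = 1 := Matrix.nonsing_inv_mul _ hdet
  have hW : R⁻¹.PosSemidef := hR.inv.posSemidef
  have hcos : 0 < Real.cos α := Real.cos_pos_of_mem_Ioo
    ⟨by linarith [hα.1, Real.pi_pos], hα.2⟩
  have hX1 := hΦpos _ (inv_lower hW hWR hRW hM h2)
  have hX2 := hΦpos _ (inv_upper hW hWR hRW hm h1)
  have hXY := hΦpos _ (sector_inv hα hA hR)
  rw [map_sub, LinearMap.map_smul_of_tower] at hX1 hX2 hXY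
  rw [hΦ1] at hX1 hX2
  set X := Φ R⁻¹ with hX
  set Y := Φ (matRe A⁻¹) with hY
  have hYpd : Y.PosDef := by
    have : Y = ((Y - Real.cos α ^ 2 • X) + Real.cos α ^ 2 • (X - M⁻¹ • 1)) +
        (Real.cos α ^ 2 * M⁻¹) • 1 := by module
    rw [this]
    exact Matrix.PosDef.posSemidef_add (hXY.add (psd_smul hX1 (by positivity)))
      (Matrix.PosDef.one.smul (by positivity))
  have hXY' : (((Real.cos α)⁻¹ ^ 2) • Y - X).PosSemidef := by
    have := psd_smul hXY (c := (Real.cos α)⁻¹ ^ 2) (by positivity)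
    rwa [smul_sub, smul_smul, ← mul_pow, inv_mul_cancel₀ hcos.ne', one_pow, one_smul] at this
  have hK := kantorovich (inv_pos.2 hM) (inv_anti₀ hm hmM) hYpd.1.eq hX1 hX2 hXY'
  have hXh : Xᴴ = X := (hΦpos _ hW).1.eq
  have hYdet : IsUnit Y.det := (Matrix.isUnit_iff_isUnit_det _).1 hYpd.isUnit
  have hYi : Y * Y⁻¹ = 1 := Matrix.mul_nonsing_inv _ hYdet
  have hYi' : Y⁻¹ * Y = 1 := Matrix.nonsing_inv_mul _ hYdet
  have hYih : (Y⁻¹)ᴴ = Y⁻¹ := hYpd.inv.1.eq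
  refine opnorm_le (by positivity) ?_
  have hK2 := psd_conj hK hYih
  have hk0 : 0 ≤ kant (M / m) := by unfold kant; positivity
  convert hK2 using 1
  rw [mul_sub, sub_mul, conjTranspose_mul, hYih, hXh, mul_smul_comm, smul_mul_assoc,
    ← mul_assoc Y⁻¹ Y Y, hYi', one_mul, hYi, mul_pow, Real.sq_sqrt hk0]
  simp only [mul_assoc]
  congr 3
  unfold kant
  field_simp
  ring
end
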